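/- The quotient ring ℤ[x₁,x₂,x₃,y₁,y₂,y₃,z]/I is a free module over the subring ℤ[y₁,y₂,y₃], with basis given by the images of the twelve monomials x₁^{i₁} x₂^{i₂} z^{j} with 0 ≤ i₁ ≤ 2, 0 ≤ i₂ ≤ 1 and j ∈ {0,1}. In particular ℤ[x₁,x₂,x₃,y₁,y₂,y₃,z]/I is free as a ℤ-module. -/

import Mathlib

open MvPolynomial

/-- `s₁ = y₁ − y₂` in `ℤ[x₁,x₂,x₃,y₁,y₂,y₃,z]`, where the variables
`x₁,x₂,x₃,y₁,y₂,y₃,z` are `X 0, X 1, X 2, X 3, X 4, X 5, X 6`. -/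
noncomputable def s1p : MvPolynomial (Fin 7) ℤ := X 3 - X 4
/-- `s₂ = y₂ − y₃`. -/
noncomputable def s2p : MvPolynomial (Fin 7) ℤ := X 4 - X 5
/-- `s₃ = y₃ − y₁`. -/
noncomputable def s3p : MvPolynomial (Fin 7) ℤ := X 5 - X 3

/-- The ideal `I` generated by `x₁+x₂+x₃`, `e₂(x) − e₂(s)`, `2z − e₃(x) − e₃(s)`
and `z² − z·e₃(s)`. -/
noncomputable def Ig2 : Ideal (MvPolynomial (Fin 7) ℤ) :=
  Ideal.span {X 0 + X 1 + X 2,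
    (X 0 * X 1 + X 0 * X 2 + X 1 * X 2) - (s1p * s2p + s1p * s3p + s2p * s3p),
    2 * X 6 - X 0 * X 1 * X 2 - s1p * s2p * s3p,
    X 6 ^ 2 - X 6 * (s1p * s2p * s3p)}

/-- The inclusion of the subring `ℤ[y₁,y₂,y₃]` into the quotient ring
`ℤ[x₁,x₂,x₃,y₁,y₂,y₃,z]/I`. -/
noncomputable def φy : MvPolynomial (Fin 3) ℤ →+* MvPolynomial (Fin 7) ℤ ⧸ Ig2 :=
  (Ideal.Quotient.mk Ig2).comp
    (eval₂Hom (Int.castRingHom (MvPolynomial (Fin 7) ℤ)) ![X 3, X 4, X 5])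


namespace QF

universe u

theorem adj2 {A : Type*} [CommRing A] (p q a b : A)
    (h : AdjoinRoot.of (Polynomial.X ^ 2 + Polynomial.C p * Polynomial.X + Polynomial.C q) a +
      AdjoinRoot.of _ b * AdjoinRoot.root _ = 0) : a = 0 ∧ b = 0 := by
  nontriviality A
  set g : Polynomial A := Polynomial.X ^ 2 + Polynomial.C p * Polynomial.X + Polynomial.C q with hg
  have hd : g.degree = 2 := by rw [hg]; compute_degree!
  have hm : g.Monic := by rw [hg]; monicity!
  have h1 : AdjoinRoot.mk g (Polynomial.C a + Polynomial.C b * Polynomial.X) = 0 := by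
    simpa using h
  rw [AdjoinRoot.mk_eq_zero] at h1
  have h2 : Polynomial.C a + Polynomial.C b * Polynomial.X = 0 := by
    by_contra hne
    refine hm.not_dvd_of_degree_lt hne ?_ h1
    rw [hd]
    refine lt_of_le_of_lt (b := 1) ?_ (by norm_num)
    compute_degree
  have e0 := congrArg (fun r => Polynomial.coeff r 0) h2
  have e1 := congrArg (fun r => Polynomial.coeff r 1) h2
  simp [Polynomial.coeff_C] at e0 e1
  exact ⟨e0, e1⟩

theorem adj3 {A : Type*} [CommRing A] (p q a b c : A)
    (h : AdjoinRoot.of (Polynomial.X ^ 3 + Polynomial.C p * Polynomial.X + Polynomial.C q) a +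
      AdjoinRoot.of _ b * AdjoinRoot.root _ + AdjoinRoot.of _ c * AdjoinRoot.root _ ^ 2 = 0) :
    a = 0 ∧ b = 0 ∧ c = 0 := by
  nontriviality A
  set g : Polynomial A := Polynomial.X ^ 3 + Polynomial.C p * Polynomial.X + Polynomial.C q with hg
  have hd : g.degree = 3 := by rw [hg]; compute_degree!
  have hm : g.Monic := by rw [hg]; monicity!
  have h1 : AdjoinRoot.mk g (Polynomial.C a + Polynomial.C b * Polynomial.X
      + Polynomial.C c * Polynomial.X ^ 2) = 0 := by
    simpa using h
  rw [AdjoinRoot.mk_eq_zero] at h1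
  have h2 : Polynomial.C a + Polynomial.C b * Polynomial.X
      + Polynomial.C c * Polynomial.X ^ 2 = 0 := by
    by_contra hne
    refine hm.not_dvd_of_degree_lt hne ?_ h1
    rw [hd]
    refine lt_of_le_of_lt (b := 2) ?_ (by norm_num)
    compute_degree
  have e0 := congrArg (fun r => Polynomial.coeff r 0) h2
  have e1 := congrArg (fun r => Polynomial.coeff r 1) h2
  have e2 := congrArg (fun r => Polynomial.coeff r 2) h2
  simp [Polynomial.coeff_C, Polynomial.coeff_X] at e0 e1 e2
  exact ⟨e0, e1, e2⟩

/-- The twelve-term combination. -/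
def comb {R Q : Type*} [CommRing R] [CommRing Q] (φ : R →+* Q) (x w z : Q)
    (c : Fin 3 → Fin 2 → Fin 2 → R) : Q :=
  ∑ i₁ : Fin 3, ∑ i₂ : Fin 2, ∑ j : Fin 2, φ (c i₁ i₂ j) * (x ^ (i₁ : ℕ) * w ^ (i₂ : ℕ) * z ^ (j : ℕ))

/-- A universal model: a tower of three monic extensions. -/
theorem model {R : Type u} [CommRing R] (E F : R) :
    ∃ (S : Type u) (_ : CommRing S) (f : R →+* S) (x w z : S),
      z ^ 2 = f F * z ∧ x ^ 3 + f E * x = 2 * z - f F ∧ w ^ 2 + x * w + (x ^ 2 + f E) = 0 ∧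
      ∀ c, comb f x w z c = 0 → c = 0 := by
  let g1 : Polynomial R := Polynomial.X ^ 2 + Polynomial.C (-F) * Polynomial.X + Polynomial.C 0
  let A := AdjoinRoot g1
  let z1 : A := AdjoinRoot.root g1
  let fA : R →+* A := AdjoinRoot.of g1
  let g2 : Polynomial A := Polynomial.X ^ 3 + Polynomial.C (fA E) * Polynomial.X +
    Polynomial.C (fA F - 2 * z1)
  let B := AdjoinRoot g2
  let x2 : B := AdjoinRoot.root g2
  let fB : A →+* B := AdjoinRoot.of g2
  let g3 : Polynomial B := Polynomial.X ^ 2 + Polynomial.C x2 * Polynomial.X +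
    Polynomial.C (x2 ^ 2 + fB (fA E))
  let D := AdjoinRoot g3
  let w3 : D := AdjoinRoot.root g3
  let fD : B →+* D := AdjoinRoot.of g3
  have r1 : z1 ^ 2 + fA (-F) * z1 + fA 0 = 0 := by
    have := AdjoinRoot.eval₂_root g1
    simpa only [g1, Polynomial.eval₂_add, Polynomial.eval₂_mul, Polynomial.eval₂_pow,
      Polynomial.eval₂_X, Polynomial.eval₂_C] using this
  have r2 : x2 ^ 3 + fB (fA E) * x2 + fB (fA F - 2 * z1) = 0 := by
    have := AdjoinRoot.eval₂_root g2
    simpa only [g2, Polynomial.eval₂_add, Polynomial.eval₂_mul, Polynomial.eval₂_pow,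
      Polynomial.eval₂_X, Polynomial.eval₂_C] using this
  have r3 : w3 ^ 2 + fD x2 * w3 + fD (x2 ^ 2 + fB (fA E)) = 0 := by
    have := AdjoinRoot.eval₂_root g3
    simpa only [g3, Polynomial.eval₂_add, Polynomial.eval₂_mul, Polynomial.eval₂_pow,
      Polynomial.eval₂_X, Polynomial.eval₂_C] using this
  have r1' := congrArg (fun t => fD (fB t)) r1
  have r2' := congrArg fD r2
  simp only [map_add, map_mul, map_pow, map_zero, map_neg, map_sub, map_ofNat] at r1' r2' r3
  refine ⟨D, inferInstance, fD.comp (fB.comp fA), fD x2, w3, fD (fB z1), ?_, ?_, ?_, ?_⟩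
  · simp only [RingHom.comp_apply]
    linear_combination r1'
  · simp only [RingHom.comp_apply]
    linear_combination r2'
  · simp only [RingHom.comp_apply]
    linear_combination r3
  · intro c hc
    have key : ∀ k : Fin 2, ∀ i : Fin 3, fA (c i k 0) + fA (c i k 1) * z1 = 0 := by
      have h3 := adj2 x2 (x2 ^ 2 + fB (fA E))
        (fB (fA (c 0 0 0) + fA (c 0 0 1) * z1) + fB (fA (c 1 0 0) + fA (c 1 0 1) * z1) * x2
          + fB (fA (c 2 0 0) + fA (c 2 0 1) * z1) * x2 ^ 2)
        (fB (fA (c 0 1 0) + fA (c 0 1 1) * z1) + fB (fA (c 1 1 0) + fA (c 1 1 1) * z1) * x2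
          + fB (fA (c 2 1 0) + fA (c 2 1 1) * z1) * x2 ^ 2) (by
          change fD _ + fD _ * w3 = 0
          rw [← hc]
          simp only [comb, Fin.sum_univ_succ, Fin.sum_univ_zero, map_add, map_mul, map_pow,
            RingHom.comp_apply]
          simp
          ring)
      intro k
      fin_cases k
      · have := adj3 _ _ _ _ _ h3.1
        intro i
        fin_cases i
        · exact this.1
        · exact this.2.1
        · exact this.2.2
      · have := adj3 _ _ _ _ _ h3.2
        intro i
        fin_cases i
        · exact this.1
        · exact this.2.1
        · exact this.2.2
    funext i k j
    have := adj2 _ _ _ _ (key k i)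
    fin_cases j
    · exact this.1
    · exact this.2

section span
variable {R Q : Type*} [CommRing R] [CommRing Q] (φ : R →+* Q) (x w z : Q) (E F : R)

theorem comb_expand (c : Fin 3 → Fin 2 → Fin 2 → R) : comb φ x w z c =
    φ (c 0 0 0) + φ (c 0 0 1) * z + φ (c 0 1 0) * w + φ (c 0 1 1) * w * z
    + φ (c 1 0 0) * x + φ (c 1 0 1) * x * z + φ (c 1 1 0) * x * w + φ (c 1 1 1) * x * w * z
    + φ (c 2 0 0) * x ^ 2 + φ (c 2 0 1) * x ^ 2 * z + φ (c 2 1 0) * x ^ 2 * w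
    + φ (c 2 1 1) * x ^ 2 * w * z := by
  simp [comb, Fin.sum_univ_succ]
  ring

theorem comb_add (c d : Fin 3 → Fin 2 → Fin 2 → R) :
    comb φ x w z (c + d) = comb φ x w z c + comb φ x w z d := by
  simp only [comb_expand, Pi.add_apply, map_add]; ring

theorem comb_smul (r : R) (c : Fin 3 → Fin 2 → Fin 2 → R) :
    comb φ x w z (fun i k j => r * c i k j) = φ r * comb φ x w z c := by
  simp only [comb_expand, map_mul]; ring

/-- membership in the span -/
def InS (q : Q) : Prop := ∃ c, q = comb φ x w z c

variable {φ x w z E F}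
theorem InS.add {p q : Q} (hp : InS φ x w z p) (hq : InS φ x w z q) : InS φ x w z (p + q) := by
  obtain ⟨c, rfl⟩ := hp
  obtain ⟨d, rfl⟩ := hq
  exact ⟨c + d, (comb_add ..).symm⟩

theorem InS.smul (r : R) {q : Q} (hq : InS φ x w z q) : InS φ x w z (φ r * q) := by
  obtain ⟨d, rfl⟩ := hq
  exact ⟨_, (comb_smul ..).symm⟩

theorem InS.mulz (h1 : z ^ 2 = φ F * z) {q : Q} (hq : InS φ x w z q) : InS φ x w z (q * z) := by
  obtain ⟨c, rfl⟩ := hq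
  refine ⟨fun i k => ![0, c i k 0 + F * c i k 1], ?_⟩
  simp only [comb_expand, Matrix.cons_val_zero, Matrix.cons_val_one, map_add, map_mul, map_zero]
  linear_combination (φ (c 0 0 1) + φ (c 0 1 1) * w + φ (c 1 0 1) * x + φ (c 1 1 1) * x * w
    + φ (c 2 0 1) * x ^ 2 + φ (c 2 1 1) * x ^ 2 * w) * h1

theorem InS.mulx (h1 : z ^ 2 = φ F * z) (h2 : x ^ 3 + φ E * x = 2 * z - φ F)
    {q : Q} (hq : InS φ x w z q) : InS φ x w z (q * x) := by
  obtain ⟨c, rfl⟩ := hq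
  refine ⟨![fun k => ![-F * c 2 k 0, 2 * c 2 k 0 + F * c 2 k 1],
    fun k j => c 0 k j - E * c 2 k j, fun k j => c 1 k j], ?_⟩
  simp only [comb_expand, Matrix.cons_val_zero, Matrix.cons_val_one, Matrix.cons_val, map_add,
    map_mul, map_sub, map_neg, map_ofNat]
  linear_combination (φ (c 2 0 0) + φ (c 2 1 0) * w + φ (c 2 0 1) * z + φ (c 2 1 1) * w * z) * h2
    + (2 * φ (c 2 0 1) + 2 * φ (c 2 1 1) * w) * h1

theorem InS.mulw (h1 : z ^ 2 = φ F * z) (h2 : x ^ 3 + φ E * x = 2 * z - φ F)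
    (h3 : w ^ 2 + x * w + (x ^ 2 + φ E) = 0)
    {q : Q} (hq : InS φ x w z q) : InS φ x w z (q * w) := by
  obtain ⟨c, rfl⟩ := hq
  have ha : InS φ x w z (comb φ x w z (fun i => ![0, c i 0])) := ⟨_, rfl⟩
  have hb : InS φ x w z (comb φ x w z (fun i => ![0, c i 1])) := ⟨_, rfl⟩
  have hd : InS φ x w z (comb φ x w z (fun i => ![c i 1, 0])) := ⟨_, rfl⟩
  have := ((ha.add ((hb.mulx h1 h2).smul (-1))).add (((hd.mulx h1 h2).mulx h1 h2).smul (-1))).add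
    (hd.smul (-E))
  convert this using 1
  simp only [comb_expand, Matrix.cons_val_zero, Matrix.cons_val_one, Pi.zero_apply, map_zero,
    map_neg, map_one]
  linear_combination (φ (c 0 1 0) + φ (c 0 1 1) * z + φ (c 1 1 0) * x + φ (c 1 1 1) * x * z
    + φ (c 2 1 0) * x ^ 2 + φ (c 2 1 1) * x ^ 2 * z) * h3

theorem InS.const (r : R) : InS φ x w z (φ r) := by
  refine ⟨![![![r, 0], 0], 0, 0], ?_⟩
  simp [comb_expand]

end span

/-- `e₂(s)` in `ℤ[y]` -/
noncomputable def E : MvPolynomial (Fin 3) ℤ :=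
  (X 0 - X 1) * (X 1 - X 2) + (X 0 - X 1) * (X 2 - X 0) + (X 1 - X 2) * (X 2 - X 0)
/-- `e₃(s)` in `ℤ[y]` -/
noncomputable def F : MvPolynomial (Fin 3) ℤ :=
  (X 0 - X 1) * (X 1 - X 2) * (X 2 - X 0)

noncomputable abbrev m (i : Fin 7) : MvPolynomial (Fin 7) ℤ ⧸ Ig2 := Ideal.Quotient.mk Ig2 (X i)

theorem φX0 : φy (X 0) = m 3 := by simp [φy]
theorem φX1 : φy (X 1) = m 4 := by simp [φy]
theorem φX2 : φy (X 2) = m 5 := by simp [φy]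

theorem rel1 : m 0 + m 1 + m 2 = 0 := by
  have : (X 0 + X 1 + X 2 : MvPolynomial (Fin 7) ℤ) ∈ Ig2 := Ideal.subset_span (by simp)
  simpa using Ideal.Quotient.eq_zero_iff_mem.2 this

theorem rel2 : m 0 * m 1 + m 0 * m 2 + m 1 * m 2 - φy E = 0 := by
  have : ((X 0 * X 1 + X 0 * X 2 + X 1 * X 2) - (s1p * s2p + s1p * s3p + s2p * s3p)
    : MvPolynomial (Fin 7) ℤ) ∈ Ig2 := Ideal.subset_span (by simp)
  simpa [E, φX0, φX1, φX2, s1p, s2p, s3p] using Ideal.Quotient.eq_zero_iff_mem.2 this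

theorem rel3 : 2 * m 6 - m 0 * m 1 * m 2 - φy F = 0 := by
  have : (2 * X 6 - X 0 * X 1 * X 2 - s1p * s2p * s3p
    : MvPolynomial (Fin 7) ℤ) ∈ Ig2 := Ideal.subset_span (by simp)
  have h2 : Ideal.Quotient.mk Ig2 2 = 2 := map_ofNat _ 2
  simpa [h2, F, φX0, φX1, φX2, s1p, s2p, s3p] using Ideal.Quotient.eq_zero_iff_mem.2 this

theorem rel4 : m 6 ^ 2 - m 6 * φy F = 0 := by
  have : (X 6 ^ 2 - X 6 * (s1p * s2p * s3p)
    : MvPolynomial (Fin 7) ℤ) ∈ Ig2 := Ideal.subset_span (by simp)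
  simpa [F, φX0, φX1, φX2, s1p, s2p, s3p] using Ideal.Quotient.eq_zero_iff_mem.2 this

theorem h1 : m 6 ^ 2 = φy F * m 6 := by linear_combination rel4
theorem h3 : m 1 ^ 2 + m 0 * m 1 + (m 0 ^ 2 + φy E) = 0 := by
  linear_combination (m 0 + m 1) * rel1 - rel2
theorem h2 : m 0 ^ 3 + φy E * m 0 = 2 * m 6 - φy F := by
  linear_combination (m 0 ^ 2) * rel1 - m 0 * rel2 - rel3

theorem spans (q : MvPolynomial (Fin 7) ℤ ⧸ Ig2) : InS φy (m 0) (m 1) (m 6) q := by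
  obtain ⟨p, rfl⟩ := Ideal.Quotient.mk_surjective q
  induction p using MvPolynomial.induction_on with
  | C a =>
    have := InS.const (φ := φy) (x := m 0) (w := m 1) (z := m 6) (C a)
    simpa [φy] using this
  | add p q hp hq => rw [map_add]; exact hp.add hq
  | mul_X p i hp =>
    rw [map_mul]
    set t := Ideal.Quotient.mk Ig2 p
    have hx : InS φy (m 0) (m 1) (m 6) (t * m 0) := hp.mulx h1 h2
    have hw : InS φy (m 0) (m 1) (m 6) (t * m 1) := hp.mulw h1 h2 h3
    fin_cases i
    · exact hx
    · exact hw
    · have := (hx.add hw).smul (-1)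
      convert this using 1
      simp only [map_neg, map_one]
      change t * m 2 = _
      linear_combination t * rel1
    · have := hp.smul (X 0)
      rw [φX0, mul_comm] at this
      exact this
    · have := hp.smul (X 1)
      rw [φX1, mul_comm] at this
      exact this
    · have := hp.smul (X 2)
      rw [φX2, mul_comm] at this
      exact this
    · exact hp.mulz h1

theorem indep (c : Fin 3 → Fin 2 → Fin 2 → MvPolynomial (Fin 3) ℤ)
    (hc : comb φy (m 0) (m 1) (m 6) c = 0) : c = 0 := by
  obtain ⟨S, _, f, x, w, z, e1, e2, e3, hS⟩ := model E F
  let g : MvPolynomial (Fin 7) ℤ →+* S :=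
    eval₂Hom (Int.castRingHom S) ![x, w, -x - w, f (X 0), f (X 1), f (X 2), z]
  have g0 : g (X 0) = x := by simp [g]
  have g1 : g (X 1) = w := by simp [g]
  have g2 : g (X 2) = -x - w := by simp [g]
  have g3 : g (X 3) = f (X 0) := by simp [g]
  have g4 : g (X 4) = f (X 1) := by simp [g]
  have g5 : g (X 5) = f (X 2) := by simp [g]
  have g6 : g (X 6) = z := by simp [g]
  simp only [E, F, map_add, map_sub, map_mul] at e1 e2 e3
  have hI : ∀ a ∈ Ig2, g a = 0 := by
    intro a ha
    have hle : Ig2 ≤ RingHom.ker g := by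
      rw [Ig2, Ideal.span_le]
      rintro b (rfl | rfl | rfl | rfl) <;>
        simp only [SetLike.mem_coe, RingHom.mem_ker, s1p, s2p, s3p, map_add, map_sub, map_mul,
          map_pow, map_ofNat, g0, g1, g2, g3, g4, g5, g6]
      · ring
      · linear_combination -e3
      · linear_combination x * e3 - e2
      · linear_combination e1
    exact hle ha
  let G : MvPolynomial (Fin 7) ℤ ⧸ Ig2 →+* S := Ideal.Quotient.lift Ig2 g hI
  have hG : G.comp φy = f := by
    apply MvPolynomial.ringHom_ext
    · intro r; simp
    · intro i
      fin_cases i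
      · exact (congrArg G φX0).trans g3
      · exact (congrArg G φX1).trans g4
      · exact (congrArg G φX2).trans g5
  apply hS
  have k0 : G (m 0) = x := g0
  have k1 : G (m 1) = w := g1
  have k6 : G (m 6) = z := g6
  have := congrArg G hc
  simpa only [comb, map_sum, map_mul, map_pow, k0, k1, k6, map_zero, ← RingHom.comp_apply, hG]
    using this

theorem comb_eq (c : Fin 3 → Fin 2 → Fin 2 → MvPolynomial (Fin 3) ℤ) :
    comb φy (m 0) (m 1) (m 6) c = ∑ i₁ : Fin 3, ∑ i₂ : Fin 2, ∑ j : Fin 2,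
          φy (c i₁ i₂ j) *
            Ideal.Quotient.mk Ig2 (X 0 ^ (i₁ : ℕ) * X 1 ^ (i₂ : ℕ) * X 6 ^ (j : ℕ)) := by
  simp only [comb, map_mul, map_pow]

theorem free : Module.Free ℤ (MvPolynomial (Fin 7) ℤ ⧸ Ig2) := by
  let L : (Fin 3 → Fin 2 → Fin 2 → MvPolynomial (Fin 3) ℤ) →+ MvPolynomial (Fin 7) ℤ ⧸ Ig2 :=
    AddMonoidHom.mk' (comb φy (m 0) (m 1) (m 6)) (comb_add _ _ _ _)
  have hL : Function.Bijective L := by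
    refine ⟨(injective_iff_map_eq_zero L).2 indep, fun q => ?_⟩
    obtain ⟨c, hc⟩ := spans q
    exact ⟨c, hc.symm⟩
  exact Module.Free.of_equiv (AddEquiv.ofBijective L hL).toIntLinearEquiv

end QF

/-- `ℤ[x₁,x₂,x₃,y₁,y₂,y₃,z]/I` is a free module over the subring `ℤ[y₁,y₂,y₃]`
with basis the images of the twelve monomials `x₁^{i₁} x₂^{i₂} z^{j}`,
`0 ≤ i₁ ≤ 2`, `0 ≤ i₂ ≤ 1`, `0 ≤ j ≤ 1`; in particular it is free as a
`ℤ`-module. -/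
theorem quotient_free_with_monomial_basis :
    (∀ q : MvPolynomial (Fin 7) ℤ ⧸ Ig2,
      ∃ c : Fin 3 → Fin 2 → Fin 2 → MvPolynomial (Fin 3) ℤ,
        q = ∑ i₁ : Fin 3, ∑ i₂ : Fin 2, ∑ j : Fin 2,
          φy (c i₁ i₂ j) *
            Ideal.Quotient.mk Ig2 (X 0 ^ (i₁ : ℕ) * X 1 ^ (i₂ : ℕ) * X 6 ^ (j : ℕ))) ∧
    (∀ c : Fin 3 → Fin 2 → Fin 2 → MvPolynomial (Fin 3) ℤ,
      (∑ i₁ : Fin 3, ∑ i₂ : Fin 2, ∑ j : Fin 2,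
          φy (c i₁ i₂ j) *
            Ideal.Quotient.mk Ig2 (X 0 ^ (i₁ : ℕ) * X 1 ^ (i₂ : ℕ) * X 6 ^ (j : ℕ))) = 0 →
        c = 0) ∧
    Module.Free ℤ (MvPolynomial (Fin 7) ℤ ⧸ Ig2) := by
  refine ⟨fun q => ?_, fun c hc => ?_, QF.free⟩
  · obtain ⟨c, hc⟩ := QF.spans q
    exact ⟨c, hc.trans (QF.comb_eq c)⟩
  · exact QF.indep c ((QF.comb_eq c).trans hc)
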